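/- Let 1<p₁,p₂<∞, 0<α<2n, α/n < 1/p₁ + 1/p₂ < 2, and 1/q = 1/p₁ + 1/p₂ − α/n with 1<q<∞. Let b be a real-valued BMO function with ‖b‖_{BMO} = 1 such that for some ε>0, some fixed cube Q, and some sequence {y_j} ⊂ ℝⁿ with |y_j| → ∞, the translated cubes Q_j = Q + y_j satisfy ⨍_{Q_j}|b − b_{Q_j}| ≥ ε for every j. Then there exist sequences {f_j} bounded in L^{p₁}(ℝⁿ) and {g_j} bounded in L^{p₂}(ℝⁿ) and a constant c>0 such that ‖[b,I_α]₁(f_j,g_j) − [b,I_α]₁(f_k,g_k)‖_{L^q} ≥ c for all j ≠ k; in particular [b,I_α]₁ is not compact from L^{p₁} × L^{p₂} to L^q. -/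

import Mathlib

open MeasureTheory Set Filter
open scoped ENNReal BigOperators Topology

noncomputable section

/-- Euclidean space `ℝⁿ`. -/
abbrev Rn (n : ℕ) : Type := EuclideanSpace ℝ (Fin n)

/-- The closed axis-parallel cube with center `c` and side length `d`. -/
def cube (n : ℕ) (c : Rn n) (d : ℝ) : Set (Rn n) :=
  {x | ∀ i : Fin n, |x i - c i| ≤ d / 2}

/-- The average `b_Q` of `b` over the cube with center `c` and side length `d`. -/
def cubeAvg (n : ℕ) (b : Rn n → ℝ) (c : Rn n) (d : ℝ) : ℝ :=
  ⨍ x in cube n c d, b x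

/-- The mean oscillation `⨍_Q |b - b_Q|` of `b` over a cube. -/
def osc (n : ℕ) (b : Rn n → ℝ) (c : Rn n) (d : ℝ) : ℝ :=
  ⨍ x in cube n c d, |b x - cubeAvg n b c d|

/-- The BMO seminorm: supremum of mean oscillations over all axis-parallel cubes. -/
def bmoNorm (n : ℕ) (b : Rn n → ℝ) : ℝ :=
  ⨆ cd : Rn n × {d : ℝ // 0 < d}, osc n b cd.1 cd.2.1

/-- `b ∈ CMO`: `b` belongs to the closure of `C_c^∞` in the BMO seminorm. -/
def MemCMO (n : ℕ) (b : Rn n → ℝ) : Prop :=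
  ∀ ε : ℝ, 0 < ε → ∃ φ : Rn n → ℝ, ContDiff ℝ (⊤ : ℕ∞) φ ∧ HasCompactSupport φ ∧
    bmoNorm n (b - φ) < ε

/-- The conjugate exponent `p' = p/(p-1)`. -/
def conjExp (p : ℝ) : ℝ := p / (p - 1)

/-- The Muckenhoupt class `A_p`. -/
def MuckenhouptAp (n : ℕ) (p : ℝ) (w : Rn n → ℝ) : Prop :=
  (∀ x, 0 ≤ w x) ∧ LocallyIntegrable w volume ∧
  ∃ C : ℝ, ∀ (c : Rn n) (d : ℝ), 0 < d →
    (⨍ x in cube n c d, w x) *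
      (⨍ x in cube n c d, w x ^ (1 - conjExp p)) ^ (p / conjExp p) ≤ C

/-- The `A_p` characteristic constant `[w]_{A_p}`. -/
def apConst (n : ℕ) (p : ℝ) (w : Rn n → ℝ) : ℝ :=
  ⨆ cd : Rn n × {d : ℝ // 0 < d},
    (⨍ x in cube n cd.1 cd.2.1, w x) *
      (⨍ x in cube n cd.1 cd.2.1, w x ^ (1 - conjExp p)) ^ (p / conjExp p)

/-- The bilinear class `A_{P,q}` for `P = (p₁,p₂)`. -/
def MuckenhouptAPq (n : ℕ) (p₁ p₂ q : ℝ) (w₁ w₂ : Rn n → ℝ) : Prop :=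
  ∃ C : ℝ, ∀ (c : Rn n) (d : ℝ), 0 < d →
    (⨍ x in cube n c d, (w₁ x * w₂ x) ^ q) *
      (⨍ x in cube n c d, w₁ x ^ (-(conjExp p₁))) ^ (q / conjExp p₁) *
      (⨍ x in cube n c d, w₂ x ^ (-(conjExp p₂))) ^ (q / conjExp p₂) ≤ C

/-- The kernel of the bilinear fractional integral `I_α`. -/
def fracKernel (n : ℕ) (α : ℝ) (x y z : Rn n) : ℝ :=
  (‖x - y‖ ^ 2 + ‖x - z‖ ^ 2) ^ (-((n : ℝ) - α / 2))

/-- The bilinear fractional integral operator `I_α`. -/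
def Iop (n : ℕ) (α : ℝ) (f g : Rn n → ℝ) (x : Rn n) : ℝ :=
  ∫ y, ∫ z, fracKernel n α x y z * (f y * g z)

/-- The first commutator `[b, I_α]₁(f,g) = I_α(bf, g) - b · I_α(f,g)`. -/
def commI (n : ℕ) (α : ℝ) (b f g : Rn n → ℝ) : Rn n → ℝ :=
  fun x => Iop n α (fun y => b y * f y) g x - b x * Iop n α f g x

/-- The weighted Lᵖ norm `(∫ |f|^p w)^{1/p}` (with value in `ℝ≥0∞`). -/
def wNorm (n : ℕ) (p : ℝ) (w : Rn n → ℝ) (f : Rn n → ℝ) : ℝ≥0∞ :=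
  (∫⁻ x, ENNReal.ofReal (|f x| ^ p * w x)) ^ (1 / p)

/-- A bilinear operator `T` is compact from `L^{p₁}(w₁) × L^{p₂}(w₂)` to `L^q(μ)` when the
image of the product of unit balls is precompact in `L^q(μ)`; equivalently (by completeness),
every sequence in the image of the unit balls admits a subsequence which is Cauchy for the
`L^q(μ)` norm. -/
def BilinCompact (n : ℕ) (p₁ p₂ q : ℝ) (w₁ w₂ μ : Rn n → ℝ)
    (T : (Rn n → ℝ) → (Rn n → ℝ) → Rn n → ℝ) : Prop :=
  ∀ F G : ℕ → Rn n → ℝ,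
    (∀ j, wNorm n p₁ w₁ (F j) ≤ 1) → (∀ j, wNorm n p₂ w₂ (G j) ≤ 1) →
    ∃ φ : ℕ → ℕ, StrictMono φ ∧
      ∀ ε : ℝ, 0 < ε → ∃ N : ℕ, ∀ j ≥ N, ∀ k ≥ N,
        wNorm n q μ (fun x => T (F (φ j)) (G (φ j)) x - T (F (φ k)) (G (φ k)) x)
          < ENNReal.ofReal ε

/-- The smoothly truncated kernel `K^δ` with implicit constant `A`. -/
def IsTruncKernel (n : ℕ) (α δ A : ℝ) (K : Rn n → Rn n → Rn n → ℝ) : Prop :=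
  ContDiff ℝ 1 (fun pt : Rn n × Rn n × Rn n => K pt.1 pt.2.1 pt.2.2) ∧
  (∀ x y z, 2 * δ < max ‖x - y‖ ‖x - z‖ → K x y z = fracKernel n α x y z) ∧
  (∀ x y z, max ‖x - y‖ ‖x - z‖ < δ → K x y z = 0) ∧
  (∀ x y z : Rn n, |K x y z| ≤ A * (‖x - y‖ + ‖x - z‖) ^ (-(2 * (n : ℝ) - α))) ∧
  (∀ x y z : Rn n,
    ‖fderiv ℝ (fun pt : Rn n × Rn n × Rn n => K pt.1 pt.2.1 pt.2.2) (x, y, z)‖ ≤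
      A * (‖x - y‖ + ‖x - z‖) ^ (-(2 * (n : ℝ) - α - 1)))

/-- The bilinear operator with kernel `K`. -/
def IopK (n : ℕ) (K : Rn n → Rn n → Rn n → ℝ) (f g : Rn n → ℝ) (x : Rn n) : ℝ :=
  ∫ y, ∫ z, K x y z * (f y * g z)

/-- The first commutator of the truncated operator. -/
def commIK (n : ℕ) (K : Rn n → Rn n → Rn n → ℝ) (b f g : Rn n → ℝ) : Rn n → ℝ :=
  fun x => IopK n K (fun y => b y * f y) g x - b x * IopK n K f g x

/-- The bilinear fractional maximal function `M_α`. -/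
def Mmax (n : ℕ) (α : ℝ) (f g : Rn n → ℝ) (x : Rn n) : ℝ :=
  ⨆ cd : {cd : Rn n × ℝ // 0 < cd.2 ∧ x ∈ cube n cd.1 cd.2},
    ((cd : Rn n × ℝ).2 ^ n) ^ (α / n) *
      ((⨍ y in cube n (cd : Rn n × ℝ).1 (cd : Rn n × ℝ).2, |f y|) *
        (⨍ z in cube n (cd : Rn n × ℝ).1 (cd : Rn n × ℝ).2, |g z|))

/-- The test function `f_j` associated to the cube with center `c`, side `d` and symbol `b`:
`f_j = |Q|^{-1/p₁} (sgn(b - b_Q) - c₀) χ_Q` where `c₀ = ⨍_Q sgn(b - b_Q)`. -/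
def testF (n : ℕ) (p₁ : ℝ) (b : Rn n → ℝ) (c : Rn n) (d : ℝ) : Rn n → ℝ :=
  indicator (cube n c d) fun y =>
    (d ^ n) ^ (-(1 / p₁)) *
      (Real.sign (b y - cubeAvg n b c d) -
        ⨍ z in cube n c d, Real.sign (b z - cubeAvg n b c d))

/-- The test function `g_j = |Q|^{-1/p₂} χ_Q` associated to the cube with center `c`, side `d`. -/
def testG (n : ℕ) (p₂ : ℝ) (c : Rn n) (d : ℝ) : Rn n → ℝ :=
  indicator (cube n c d) fun _ => (d ^ n) ^ (-(1 / p₂))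

end


lemma aux_cube_eq (n : ℕ) (c : Rn n) (d : ℝ) :
    cube n c d = (WithLp.ofLp : Rn n → (Fin n → ℝ)) ⁻¹'
      (Set.univ.pi fun i => Set.Icc (c i - d/2) (c i + d/2)) := by
  ext x
  simp only [cube, Set.mem_ofPred_eq, Set.mem_preimage, Set.mem_univ_pi, Set.mem_Icc, abs_le]
  refine forall_congr' fun i => ?_
  constructor <;> rintro ⟨h1, h2⟩ <;> constructor <;> linarith

lemma aux_cube_meas (n : ℕ) (c : Rn n) (d : ℝ) : MeasurableSet (cube n c d) := by
  rw [aux_cube_eq]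
  exact (PiLp.volume_preserving_ofLp (Fin n)).measurable
    (MeasurableSet.univ_pi fun i => measurableSet_Icc)

lemma aux_cube_vol (n : ℕ) (c : Rn n) (d : ℝ) :
    volume (cube n c d) = ENNReal.ofReal d ^ n := by
  rw [aux_cube_eq, (PiLp.volume_preserving_ofLp (Fin n)).measure_preimage
    (MeasurableSet.univ_pi fun i => measurableSet_Icc).nullMeasurableSet, volume_pi_pi]
  simp

lemma aux_cube_real (n : ℕ) (c : Rn n) (d : ℝ) (hd : 0 < d) :
    volume.real (cube n c d) = d ^ n := by
  rw [Measure.real, aux_cube_vol, ENNReal.toReal_pow, ENNReal.toReal_ofReal hd.le]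

lemma aux_cube_ne_top (n : ℕ) (c : Rn n) (d : ℝ) : volume (cube n c d) ≠ ⊤ := by
  rw [aux_cube_vol]; exact ENNReal.pow_ne_top ENNReal.ofReal_ne_top

lemma aux_cube_norm (n : ℕ) (c x : Rn n) (d : ℝ) (hx : x ∈ cube n c d) :
    ‖x - c‖ ≤ √(n * (d/2)^2) := by
  rw [EuclideanSpace.norm_eq]
  apply Real.sqrt_le_sqrt
  calc ∑ i, ‖(x - c) i‖^2 ≤ ∑ i : Fin n, (d/2)^2 := by
        apply Finset.sum_le_sum
        intro i _
        have := hx i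
        gcongr
        simpa using this
    _ = n * (d/2)^2 := by simp

lemma aux_int (n : ℕ) (b : Rn n → ℝ) (hb : LocallyIntegrable b volume) (c : Rn n) (d : ℝ) :
    IntegrableOn b (cube n c d) volume := by
  refine (hb.integrableOn_isCompact (isCompact_closedBall c (√(n * (d/2)^2)))).mono_set ?_
  intro x hx
  rw [mem_closedBall_iff_norm]
  exact aux_cube_norm n c x d hx

lemma aux_int_sub (n : ℕ) (b : Rn n → ℝ) (hb : LocallyIntegrable b volume) (c : Rn n) (d t : ℝ) :
    IntegrableOn (fun x => |b x - t|) (cube n c d) volume := by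
  have h : IntegrableOn (fun x => b x - t) (cube n c d) volume :=
    Integrable.sub (aux_int n b hb c d) (integrableOn_const (aux_cube_ne_top n c d))
  exact h.abs

lemma aux_osc_le (n : ℕ) (b : Rn n → ℝ) (hbmo : bmoNorm n b = 1) (c : Rn n) (d : ℝ) (hd : 0 < d) :
    osc n b c d ≤ 1 := by
  rw [← hbmo]
  have hB : BddAbove (Set.range fun cd : Rn n × {d : ℝ // 0 < d} => osc n b cd.1 cd.2.1) := by
    by_contra h
    have : bmoNorm n b = 0 := Real.iSup_of_not_bddAbove h
    linarith
  exact le_ciSup hB (c, ⟨d, hd⟩)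

lemma aux_osc_eq (n : ℕ) (b : Rn n → ℝ) (c : Rn n) (d : ℝ) (hd : 0 < d) :
    ∫ x in cube n c d, |b x - cubeAvg n b c d| = d^n * osc n b c d := by
  rw [osc, setAverage_eq, aux_cube_real n c d hd, smul_eq_mul]
  field_simp

lemma aux_avg_sub (n : ℕ) (b : Rn n → ℝ) (hb : LocallyIntegrable b volume) (c : Rn n) (d t : ℝ)
    (hd : 0 < d) :
    d^n * |cubeAvg n b c d - t| ≤ ∫ x in cube n c d, |b x - t| := by
  have h1 : ∫ x in cube n c d, (b x - t) = d^n * (cubeAvg n b c d - t) := by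
    rw [integral_sub (aux_int n b hb c d) (integrableOn_const (aux_cube_ne_top n c d))]
    rw [cubeAvg, setAverage_eq, aux_cube_real n c d hd, smul_eq_mul]
    simp [aux_cube_real n c d hd]
    field_simp
  have h2 := abs_integral_le_integral_abs (μ := volume.restrict (cube n c d)) (f := fun x => b x - t)
  rw [h1, abs_mul, abs_of_pos (by positivity : 0 < d^n)] at h2
  exact h2

lemma aux_step (n : ℕ) (b : Rn n → ℝ) (hb : LocallyIntegrable b volume) (hbmo : bmoNorm n b = 1)
    (c c' : Rn n) (d : ℝ) (hd : 0 < d) (hsub : cube n c d ⊆ cube n c' (2*d)) :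
    |cubeAvg n b c d - cubeAvg n b c' (2*d)| ≤ 2^n := by
  have h1 := aux_avg_sub n b hb c d (cubeAvg n b c' (2*d)) hd
  have h2 : ∫ x in cube n c d, |b x - cubeAvg n b c' (2*d)| ≤
      ∫ x in cube n c' (2*d), |b x - cubeAvg n b c' (2*d)| :=
    setIntegral_mono_set (aux_int_sub n b hb _ _ _) (ae_of_all _ fun x => abs_nonneg _)
      hsub.eventuallyLE
  rw [aux_osc_eq n b c' (2*d) (by linarith)] at h2
  have h3 := aux_osc_le n b hbmo c' (2*d) (by linarith)
  have h4 : (2*d)^n * osc n b c' (2*d) ≤ (2*d)^n * 1 := by gcongr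
  have h5 : d^n * |cubeAvg n b c d - cubeAvg n b c' (2*d)| ≤ d^n * 2^n := by
    calc _ ≤ _ := h1.trans (h2.trans h4)
      _ = _ := by rw [mul_pow]; ring
  exact le_of_mul_le_mul_left h5 (by positivity)

lemma aux_chain (n : ℕ) (b : Rn n → ℝ) (hb : LocallyIntegrable b volume) (hbmo : bmoNorm n b = 1)
    (c : Rn n) (d : ℝ) (hd : 0 < d) (i : ℕ) :
    |cubeAvg n b c d - cubeAvg n b c (2^i*d)| ≤ 2^n * i := by
  induction i with
  | zero => simp
  | succ i ih =>
    have h : cube n c (2^i*d) ⊆ cube n c (2*(2^i*d)) := by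
      intro x hx k
      have := hx k
      have : 0 < 2^i*d := by positivity
      linarith
    have h2 := aux_step n b hb hbmo c c (2^i*d) (by positivity) h
    rw [show (2:ℝ)^(i+1)*d = 2*(2^i*d) by ring]
    have := abs_sub_le (cubeAvg n b c d) (cubeAvg n b c (2^i*d)) (cubeAvg n b c (2*(2^i*d)))
    push_cast
    linarith

lemma aux_far (n : ℕ) (b : Rn n → ℝ) (hb : LocallyIntegrable b volume) (hbmo : bmoNorm n b = 1)
    (a c : Rn n) (d : ℝ) (hd : 0 < d) (m : ℕ) (h : ‖a - c‖ ≤ 2^(m+1)*d) :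
    |cubeAvg n b a d - cubeAvg n b c d| ≤ 2^n * (2*m+6) := by
  have h1 := aux_chain n b hb hbmo c d hd (m+2)
  have h2 := aux_chain n b hb hbmo a d hd (m+3)
  have hs : cube n c (2^(m+2)*d) ⊆ cube n a (2*(2^(m+2)*d)) := by
    intro x hx k
    have h3 := hx k
    have h4 : |a k - c k| ≤ ‖a - c‖ := by
      simpa using PiLp.norm_apply_le (a - c) k
    have h5 : |x k - a k| ≤ |x k - c k| + |a k - c k| := by
      rw [abs_sub_comm (a k)]; exact abs_sub_le _ _ _
    have : (2:ℝ)^(m+2)*d = 2 * (2^(m+1)*d) := by ring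
    rw [this] at h3 ⊢
    linarith
  have h3 := aux_step n b hb hbmo c a _ (by positivity) hs
  rw [show 2*((2:ℝ)^(m+2)*d) = 2^(m+3)*d by ring] at h3
  rw [abs_le] at *
  push_cast at *
  constructor <;> linarith [h1.1, h1.2, h2.1, h2.2, h3.1, h3.2]

lemma aux_median_real (ν : Measure ℝ) [IsFiniteMeasure ν] :
    ∃ m : ℝ, ν univ ≤ 2 * ν (Iic m) ∧ ν univ ≤ 2 * ν (Ici m) := by
  rcases eq_or_ne (ν univ) 0 with h0 | h0
  · exact ⟨0, by simp [h0], by simp [h0]⟩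
  set S : Set ℝ := {t | ν univ ≤ 2 * ν (Iic t)} with hS
  have hlt : ν univ / 2 < ν univ := ENNReal.half_lt_self h0 (measure_ne_top _ _)
  have hne : S.Nonempty := by
    have h1 := tendsto_measure_Iic_atTop ν
    obtain ⟨t, ht⟩ := (h1.eventually (lt_mem_nhds hlt)).exists
    refine ⟨t, ?_⟩
    have := ENNReal.div_le_iff_le_mul (a := ν univ) (b := 2) (c := ν (Iic t)) (by simp) (by simp)
    show ν univ ≤ 2 * ν (Iic t)
    rw [mul_comm]; exact this.1 ht.le
  have hbdd : BddBelow S := by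
    have h1 := tendsto_measure_Ici_atBot ν
    obtain ⟨t, ht⟩ := (h1.eventually (lt_mem_nhds hlt)).exists
    refine ⟨t, fun s hs => ?_⟩
    by_contra hc
    push Not at hc
    have h2 : ν (Iic s) + ν (Ici t) ≤ ν univ := by
      rw [← measure_union _ measurableSet_Ici]
      · exact measure_mono (subset_univ _)
      · rw [Set.disjoint_left]; intro z hz hz'; simp only [mem_Iic, mem_Ici] at hz hz'; linarith
    have h3 : ν univ / 2 ≤ ν (Iic s) := by
      apply ENNReal.div_le_of_le_mul; rw [mul_comm]; exact hs
    have h4 : ν univ / 2 + ν univ / 2 < ν (Iic s) + ν (Ici t) :=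
      ENNReal.add_lt_add_of_le_of_lt (by finiteness) h3 ht
    rw [ENNReal.add_halves] at h4
    exact absurd (h4.trans_le h2) (lt_irrefl _)
  have hpos : ∀ k : ℕ, (0:ℝ) < 1 / ((k:ℝ)+1) := fun k => by positivity
  refine ⟨sInf S, ?_, ?_⟩
  · have hI : Iic (sInf S) = ⋂ k : ℕ, Iic (sInf S + 1 / ((k:ℝ)+1)) := by
      ext z
      simp only [mem_Iic, mem_iInter]
      constructor
      · intro h k; linarith [hpos k]
      · intro h
        refine le_of_forall_pos_le_add fun e he => ?_
        obtain ⟨k, hk⟩ := exists_nat_one_div_lt he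
        linarith [h k]
    have ht := tendsto_measure_iInter_atTop (μ := ν) (s := fun k : ℕ => Iic (sInf S + 1 / ((k:ℝ)+1)))
      (fun k => measurableSet_Iic.nullMeasurableSet)
      (fun i j hij => Iic_subset_Iic.2 (by gcongr)) ⟨0, measure_ne_top _ _⟩
    rw [← hI] at ht
    have ht2 := ENNReal.Tendsto.const_mul (a := 2) ht (Or.inr (by simp))
    refine ge_of_tendsto' ht2 fun k => ?_
    obtain ⟨s, hs, hs'⟩ := exists_lt_of_csInf_lt hne (show sInf S < sInf S + 1 / ((k:ℝ)+1) by linarith [hpos k])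
    have hs2 : ν univ ≤ 2 * ν (Iic s) := hs
    refine hs2.trans ?_
    simp only [Function.comp]
    gcongr
  · have hI : Iio (sInf S) = ⋃ k : ℕ, Iic (sInf S - 1 / ((k:ℝ)+1)) := by
      ext z
      simp only [mem_Iio, mem_iUnion, mem_Iic]
      constructor
      · intro h
        obtain ⟨k, hk⟩ := exists_nat_one_div_lt (sub_pos.2 h)
        exact ⟨k, by linarith⟩
      · rintro ⟨k, hk⟩
        linarith [hpos k]
    have ht := tendsto_measure_iUnion_atTop (μ := ν) (s := fun k : ℕ => Iic (sInf S - 1 / ((k:ℝ)+1)))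
      (fun i j hij => Iic_subset_Iic.2 (by gcongr))
    rw [← hI] at ht
    have h5 : ν (Iio (sInf S)) ≤ ν univ / 2 := by
      refine le_of_tendsto' ht fun k => ?_
      have hk : sInf S - 1 / ((k:ℝ)+1) ∉ S := fun h => by
        have := csInf_le hbdd h
        linarith [hpos k]
      simp only [hS, mem_ofPred_eq, not_le] at hk
      rw [ENNReal.le_div_iff_mul_le (by simp) (by simp), mul_comm]
      exact hk.le
    have h6 : ν (Iio (sInf S)) + ν (Ici (sInf S)) = ν univ := by
      rw [← compl_Iio]; exact measure_add_measure_compl measurableSet_Iio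
    have h7 : ν univ / 2 ≤ ν (Ici (sInf S)) := by
      by_contra hc
      push Not at hc
      have : ν (Iio (sInf S)) + ν (Ici (sInf S)) < ν univ / 2 + ν univ / 2 :=
        ENNReal.add_lt_add_of_le_of_lt (measure_ne_top _ _) h5 hc
      rw [h6, ENNReal.add_halves] at this
      exact lt_irrefl _ this
    rw [ENNReal.div_le_iff_le_mul (by simp) (by simp), mul_comm] at h7
    exact h7

lemma aux_median (n : ℕ) (b : Rn n → ℝ) (hb : LocallyIntegrable b volume) (a : Rn n) (d : ℝ)
    (hd : 0 < d) :
    ∃ m : ℝ, d^n / 2 ≤ volume.real ({x | b x ≤ m} ∩ cube n a d) ∧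
      d^n / 2 ≤ volume.real ({x | m ≤ b x} ∩ cube n a d) := by
  have hfin : IsFiniteMeasure (volume.restrict (cube n a d)) :=
    ⟨by rw [Measure.restrict_apply_univ]; exact (aux_cube_ne_top n a d).lt_top⟩
  have hbm : AEMeasurable b (volume.restrict (cube n a d)) :=
    (aux_int n b hb a d).aestronglyMeasurable.aemeasurable
  obtain ⟨m, h1, h2⟩ := aux_median_real ((volume.restrict (cube n a d)).map b)
  rw [Measure.map_apply_of_aemeasurable hbm MeasurableSet.univ,
    Measure.map_apply_of_aemeasurable hbm measurableSet_Iic, preimage_univ,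
    Measure.restrict_apply_univ, Measure.restrict_apply' (aux_cube_meas n a d)] at h1
  rw [Measure.map_apply_of_aemeasurable hbm MeasurableSet.univ,
    Measure.map_apply_of_aemeasurable hbm measurableSet_Ici, preimage_univ,
    Measure.restrict_apply_univ, Measure.restrict_apply' (aux_cube_meas n a d)] at h2
  have key : ∀ s : Set (Rn n), volume (cube n a d) ≤ 2 * volume (s ∩ cube n a d) →
      d^n / 2 ≤ volume.real (s ∩ cube n a d) := by
    intro s hs
    have hne : volume (s ∩ cube n a d) ≠ ⊤ := 
      measure_ne_top_of_subset inter_subset_right (aux_cube_ne_top n a d)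
    have := ENNReal.toReal_mono (by finiteness) hs
    rw [ENNReal.toReal_mul] at this
    change volume.real (cube n a d) ≤ _ * volume.real (s ∩ cube n a d) at this
    rw [aux_cube_real n a d hd] at this
    simp at this
    linarith
  exact ⟨m, key _ h1, key _ h2⟩

lemma aux_Iop_scale (n : ℕ) (α s t : ℝ) (f g : Rn n → ℝ) (x : Rn n) :
    Iop n α (fun y => s * f y) (fun z => t * g z) x = s * t * Iop n α f g x := by
  unfold Iop
  rw [← integral_const_mul]
  congr 1; funext y
  rw [← integral_const_mul]
  congr 1; funext z
  ring

lemma aux_commI_scale (n : ℕ) (α s t : ℝ) (b f g : Rn n → ℝ) (x : Rn n) :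
    commI n α b (fun y => s * f y) (fun z => t * g z) x = s * t * commI n α b f g x := by
  unfold commI
  rw [aux_Iop_scale]
  have : (fun y => b y * (s * f y)) = fun y => s * (b y * f y) := by funext y; ring
  rw [this, aux_Iop_scale]
  ring

/-- The kernel integrated over `Q` in the last variable. -/
noncomputable def auxK (n : ℕ) (α : ℝ) (Q : Set (Rn n)) (x y : Rn n) : ℝ :=
  ∫ z in Q, fracKernel n α x y z

lemma auxK_meas (n : ℕ) (α : ℝ) (Q : Set (Rn n)) (x : Rn n) :
    StronglyMeasurable (auxK n α Q x) := by
  unfold auxK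
  apply StronglyMeasurable.integral_prod_right
  apply Measurable.stronglyMeasurable
  unfold fracKernel Function.uncurry
  fun_prop

lemma aux_frac_nonneg (n : ℕ) (α : ℝ) (x y z : Rn n) : 0 ≤ fracKernel n α x y z := by
  unfold fracKernel; positivity

lemma auxK_bounds (n : ℕ) (α : ℝ) (Q : Set (Rn n)) (hQ : MeasurableSet Q) (hQf : volume Q ≠ ⊤)
    (x y : Rn n) (κ M : ℝ)
    (h : ∀ z ∈ Q, κ ≤ fracKernel n α x y z ∧ fracKernel n α x y z ≤ M) :
    κ * volume.real Q ≤ auxK n α Q x y ∧ auxK n α Q x y ≤ M * volume.real Q := by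
  have hint : IntegrableOn (fun z => fracKernel n α x y z) Q volume := by
    refine Integrable.mono' (integrableOn_const (C := M) hQf) ?_ ?_
    · apply Measurable.aestronglyMeasurable
      unfold fracKernel
      fun_prop
    · rw [ae_restrict_iff' hQ]
      refine ae_of_all _ fun z hz => ?_
      rw [Real.norm_of_nonneg (aux_frac_nonneg _ _ _ _ _)]
      exact (h z hz).2
  constructor
  · calc κ * volume.real Q = ∫ z in Q, κ := by simp [mul_comm]
      _ ≤ _ := setIntegral_mono_on (integrableOn_const hQf) hint hQ fun z hz => (h z hz).1
  · calc auxK n α Q x y ≤ ∫ z in Q, M :=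
        setIntegral_mono_on hint (integrableOn_const hQf) hQ fun z hz => (h z hz).2
      _ = _ := by simp [mul_comm]

lemma aux_Iop_ind (n : ℕ) (α : ℝ) (Q : Set (Rn n)) (hQ : MeasurableSet Q) (f : Rn n → ℝ)
    (x : Rn n) :
    Iop n α f (Q.indicator fun _ => 1) x = ∫ y, f y * auxK n α Q x y := by
  unfold Iop auxK
  congr 1; funext y
  rw [← integral_const_mul, ← integral_indicator hQ]
  congr 1; funext z
  by_cases hz : z ∈ Q <;> simp [hz]
  ring

lemma aux_commI_eq (n : ℕ) (α : ℝ) (b : Rn n → ℝ) (Q S : Set (Rn n)) (hQ : MeasurableSet Q)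
    (hQf : volume Q ≠ ⊤) (hS : NullMeasurableSet S volume) (hSQ : S ⊆ Q)
    (hb : IntegrableOn b Q volume) (x : Rn n) (M : ℝ)
    (h : ∀ y ∈ Q, ∀ z ∈ Q, fracKernel n α x y z ≤ M) :
    IntegrableOn (fun y => (b y - b x) * auxK n α Q x y) S volume ∧
    commI n α b (S.indicator fun _ => 1) (Q.indicator fun _ => 1) x
      = ∫ y in S, (b y - b x) * auxK n α Q x y := by
  have hKb : ∀ᵐ y ∂(volume.restrict S), ‖auxK n α Q x y‖ ≤ M * volume.real Q := by
    rw [ae_restrict_iff'₀ hS]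
    refine ae_of_all _ fun y hy => ?_
    have := auxK_bounds n α Q hQ hQf x y 0 M
      fun z hz => ⟨aux_frac_nonneg _ _ _ _ _, h y (hSQ hy) z hz⟩
    rw [Real.norm_of_nonneg (by linarith [this.1])]
    exact this.2
  have hSf : volume S ≠ ⊤ := measure_ne_top_of_subset hSQ hQf
  have i1 : IntegrableOn (fun y => b y * auxK n α Q x y) S volume :=
    Integrable.mul_bdd (hb.mono_set hSQ) (auxK_meas n α Q x).aestronglyMeasurable hKb
  have i2 : IntegrableOn (fun y => b x * auxK n α Q x y) S volume :=
    Integrable.mul_bdd (integrableOn_const hSf) (auxK_meas n α Q x).aestronglyMeasurable hKb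
  have e : (fun y => (b y - b x) * auxK n α Q x y) =
    fun y => b y * auxK n α Q x y - b x * auxK n α Q x y := by funext y; ring
  refine ⟨by rw [e]; exact i1.sub i2, ?_⟩
  unfold commI
  rw [aux_Iop_ind n α Q hQ, aux_Iop_ind n α Q hQ, e, integral_sub i1 i2, integral_const_mul,
    ← integral_indicator₀ hS, ← integral_indicator₀ hS]
  congr 2
  · funext y
    by_cases hz : y ∈ S <;> simp [hz]
  · congr 1; funext y
    by_cases hz : y ∈ S <;> simp [hz]

lemma aux_upper (n : ℕ) (α : ℝ) (b : Rn n → ℝ) (Q S : Set (Rn n)) (hQ : MeasurableSet Q)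
    (hQf : volume Q ≠ ⊤) (hS : NullMeasurableSet S volume) (hSQ : S ⊆ Q)
    (hb : IntegrableOn b Q volume) (x : Rn n) (M : ℝ)
    (h : ∀ y ∈ Q, ∀ z ∈ Q, fracKernel n α x y z ≤ M) :
    |commI n α b (S.indicator fun _ => 1) (Q.indicator fun _ => 1) x| ≤
      M * volume.real Q * ∫ y in Q, |b y - b x| := by
  obtain ⟨hi, he⟩ := aux_commI_eq n α b Q S hQ hQf hS hSQ hb x M h
  have hbi : IntegrableOn (fun y => |b y - b x|) Q volume :=
    (Integrable.sub hb (integrableOn_const hQf)).abs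
  rcases S.eq_empty_or_nonempty with hSe | ⟨y0, hy0⟩
  · subst hSe
    rcases Q.eq_empty_or_nonempty with hQe | ⟨y0, hy0⟩
    · subst hQe; rw [he]; simp
    rw [he]; simp
    have : 0 ≤ M := (aux_frac_nonneg n α x y0 y0).trans (h y0 hy0 y0 hy0)
    have : 0 ≤ ∫ y in Q, |b y - b x| := integral_nonneg fun y => abs_nonneg _
    positivity
  have hM : 0 ≤ M := (aux_frac_nonneg n α x y0 y0).trans (h y0 (hSQ hy0) y0 (hSQ hy0))
  rw [he]
  calc _ ≤ ∫ y in S, |(b y - b x) * auxK n α Q x y| := abs_integral_le_integral_abs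
    _ ≤ ∫ y in S, M * volume.real Q * |b y - b x| := by
        refine integral_mono_ae hi.abs ((hbi.mono_set hSQ).const_mul _) ?_
        rw [Filter.EventuallyLE, ae_restrict_iff'₀ hS]
        refine ae_of_all _ fun y hy => ?_
        have := auxK_bounds n α Q hQ hQf x y 0 M
          fun z hz => ⟨aux_frac_nonneg _ _ _ _ _, h y (hSQ hy) z hz⟩
        rw [abs_mul, mul_comm, abs_of_nonneg (by linarith [this.1] : 0 ≤ auxK n α Q x y)]
        exact mul_le_mul_of_nonneg_right this.2 (abs_nonneg _)
    _ = M * volume.real Q * ∫ y in S, |b y - b x| := integral_const_mul _ _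
    _ ≤ _ := by
        have h0 : 0 ≤ M * volume.real Q := by positivity
        exact mul_le_mul_of_nonneg_left
          (setIntegral_mono_set hbi (ae_of_all _ fun x => abs_nonneg _) hSQ.eventuallyLE) h0

lemma aux_lower (n : ℕ) (α : ℝ) (b : Rn n → ℝ) (Q S : Set (Rn n)) (hQ : MeasurableSet Q)
    (hQf : volume Q ≠ ⊤) (hS : NullMeasurableSet S volume) (hSQ : S ⊆ Q)
    (hb : IntegrableOn b Q volume) (x : Rn n) (κ M σ m : ℝ) (hκ : 0 ≤ κ) (hσ : |σ| = 1)
    (h : ∀ y ∈ Q, ∀ z ∈ Q, κ ≤ fracKernel n α x y z ∧ fracKernel n α x y z ≤ M)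
    (hx : ∀ y ∈ S, |b y - m| ≤ σ * (b y - b x)) :
    κ * volume.real Q * ∫ y in S, |b y - m| ≤ 
      |commI n α b (S.indicator fun _ => 1) (Q.indicator fun _ => 1) x| := by
  obtain ⟨hi, he⟩ := aux_commI_eq n α b Q S hQ hQf hS hSQ hb x M fun y hy z hz => (h y hy z hz).2
  have hbi : IntegrableOn (fun y => |b y - m|) Q volume :=
    (Integrable.sub hb (integrableOn_const hQf)).abs
  rw [he]
  calc κ * volume.real Q * ∫ y in S, |b y - m| = ∫ y in S, κ * volume.real Q * |b y - m| :=
        (integral_const_mul _ _).symm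
    _ ≤ ∫ y in S, σ * ((b y - b x) * auxK n α Q x y) := by
        refine integral_mono_ae ((hbi.mono_set hSQ).const_mul _) (hi.const_mul _) ?_
        rw [Filter.EventuallyLE, ae_restrict_iff'₀ hS]
        refine ae_of_all _ fun y hy => ?_
        have := auxK_bounds n α Q hQ hQf x y κ M (h y (hSQ hy))
        rw [← mul_assoc, mul_comm]
        have h0 : 0 ≤ κ * volume.real Q := by positivity
        exact mul_le_mul (hx y hy) this.1 h0 ((abs_nonneg _).trans (hx y hy))
    _ = σ * ∫ y in S, (b y - b x) * auxK n α Q x y := integral_const_mul _ _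
    _ ≤ |σ * ∫ y in S, (b y - b x) * auxK n α Q x y| := le_abs_self _
    _ = _ := by rw [abs_mul, hσ, one_mul]

lemma aux_frac_upper (n : ℕ) (α r : ℝ) (hα : α < 2 * n) (hr : 0 < r) (x y z : Rn n)
    (h1 : r ≤ ‖x - y‖) (h2 : r ≤ ‖x - z‖) :
    fracKernel n α x y z ≤ (2 * r^2) ^ (-((n:ℝ) - α/2)) := by
  unfold fracKernel
  apply Real.rpow_le_rpow_of_nonpos (by positivity)
  · have : r^2 ≤ ‖x-y‖^2 := by gcongr
    have : r^2 ≤ ‖x-z‖^2 := by gcongr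
    linarith
  · linarith

lemma aux_frac_lower (n : ℕ) (α r R : ℝ) (hα : α < 2 * n) (hr : 0 < r) (x y z : Rn n)
    (h0 : r ≤ ‖x - y‖) (h1 : ‖x - y‖ ≤ R) (h2 : ‖x - z‖ ≤ R) :
    (2 * R^2) ^ (-((n:ℝ) - α/2)) ≤ fracKernel n α x y z := by
  unfold fracKernel
  apply Real.rpow_le_rpow_of_nonpos
  · have : 0 < ‖x - y‖ := by linarith
    positivity
  · have : ‖x-y‖^2 ≤ R^2 := by gcongr
    have : ‖x-z‖^2 ≤ R^2 := by gcongr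
    linarith
  · linarith

lemma aux_local (n : ℕ) (hn : 0 < n) (α : ℝ) (hα : α < 2 * n) (b : Rn n → ℝ)
    (hb : LocallyIntegrable b volume) (ε : ℝ) (hε : 0 < ε) (d : ℝ) (hd : 0 < d) :
    ∃ (v : Rn n) (c1 : ℝ), 0 < c1 ∧ ∀ c, ε ≤ osc n b c d → ∃ S E : Set (Rn n),
      S ⊆ cube n c d ∧ NullMeasurableSet S volume ∧ E ⊆ cube n (c + v) d ∧
      NullMeasurableSet E volume ∧ d^n/2 ≤ volume.real E ∧
      ∀ x ∈ E, c1 ≤ |commI n α b (S.indicator fun _ => 1) ((cube n c d).indicator fun _ => 1) x| := by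
  set i0 : Fin n := ⟨0, hn⟩
  set v : Rn n := EuclideanSpace.single i0 (2*d) with hv
  set D := √(n * (d/2)^2) with hD
  have hD0 : 0 ≤ D := Real.sqrt_nonneg _
  have hvpos : 0 < ‖v‖ := by rw [hv]; simp; exact hd.ne'
  set R := ‖v‖ + 2 * D with hR
  have hRpos : 0 < R := by positivity
  set κ := (2 * R^2) ^ (-((n:ℝ) - α/2)) with hκ
  have hκpos : 0 < κ := by positivity
  refine ⟨v, κ * d^n * (d^n * ε / 4), by positivity, ?_⟩
  intro c hosc
  obtain ⟨m, hm1, hm2⟩ := aux_median n b hb (c + v) d hd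
  have hbm : AEMeasurable b volume := hb.aestronglyMeasurable.aemeasurable
  have hQ := aux_cube_meas n c d
  have hA := aux_cube_meas n (c+v) d
  have hQf := aux_cube_ne_top n c d
  have hbi := aux_int n b hb c d
  have hker : ∀ x ∈ cube n (c+v) d, ∀ y ∈ cube n c d, ∀ z ∈ cube n c d,
      κ ≤ fracKernel n α x y z ∧ fracKernel n α x y z ≤ (2 * d^2) ^ (-((n:ℝ) - α/2)) := by
    intro x hx y hy z hz
    have lo : ∀ y ∈ cube n c d, d ≤ ‖x - y‖ := by
      intro y hy
      have h1 := hx i0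
      have h2 := hy i0
      have h3 : |x i0 - y i0| ≤ ‖x - y‖ := by simpa using PiLp.norm_apply_le (x - y) i0
      have h4 : (c + v) i0 = c i0 + 2 * d := by simp [hv]
      rw [h4] at h1
      rw [abs_le] at h1 h2 h3
      linarith [h1.1, h2.2, h3.2]
    have up : ∀ y ∈ cube n c d, ‖x - y‖ ≤ R := by
      intro y hy
      have h1 := aux_cube_norm n _ x d hx
      have h2 := aux_cube_norm n _ y d hy
      have h3 : x - y = (x - (c+v)) + v - (y - c) := by abel
      rw [h3]
      have := norm_sub_le ((x - (c+v)) + v) (y - c)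
      have := norm_add_le (x - (c+v)) v
      linarith
    exact ⟨aux_frac_lower n α d R hα hd x y z (lo y hy) (up y hy) (up z hz),
      aux_frac_upper n α d hα hd x y z (lo y hy) (lo z hz)⟩
  have hQm : d^n * ε ≤ 2 * ∫ x in cube n c d, |b x - m| := by
    have h1 := aux_avg_sub n b hb c d m hd
    have h2 := aux_osc_eq n b c d hd
    have h3 : ∫ x in cube n c d, |b x - cubeAvg n b c d| ≤
        ∫ x in cube n c d, (|b x - m| + |cubeAvg n b c d - m|) := by
      refine integral_mono (aux_int_sub n b hb _ _ _)
        ((aux_int_sub n b hb _ _ _).add (integrableOn_const hQf)) fun x => ?_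
      have := abs_sub_le (b x) m (cubeAvg n b c d)
      rw [abs_sub_comm m] at this
      exact this
    rw [integral_add (aux_int_sub n b hb _ _ _) (integrableOn_const hQf)] at h3
    simp only [integral_const, measureReal_restrict_apply_univ, aux_cube_real n c d hd,
      smul_eq_mul] at h3
    have h4 : d^n * ε ≤ d^n * osc n b c d := by gcongr
    linarith
  have hsplit := integral_inter_add_sdiff₀ (μ := volume) (s := cube n c d) (t := {y | m ≤ b y})
    (f := fun y => |b y - m|) (nullMeasurableSet_le aemeasurable_const hbm) (aux_int_sub n b hb _ _ _)
  have fin : ∀ (S E : Set (Rn n)) (σ : ℝ), |σ| = 1 → S ⊆ cube n c d → NullMeasurableSet S volume →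
      E ⊆ cube n (c + v) d → d^n * ε / 4 ≤ ∫ y in S, |b y - m| →
      (∀ x ∈ E, ∀ y ∈ S, |b y - m| ≤ σ * (b y - b x)) →
      ∀ x ∈ E, κ * d^n * (d^n * ε / 4) ≤
        |commI n α b (S.indicator fun _ => 1) ((cube n c d).indicator fun _ => 1) x| := by
    intro S E σ hσ hSQ hS hE hint hbs x hx
    have := aux_lower n α b (cube n c d) S hQ hQf hS hSQ hbi x κ _ σ m hκpos.le hσ
      (hker x (hE hx)) (hbs x hx)
    refine le_trans ?_ this
    rw [aux_cube_real n c d hd]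
    gcongr
  by_cases hcase : d^n * ε / 4 ≤ ∫ y in cube n c d ∩ {y | m ≤ b y}, |b y - m|
  · have hS : NullMeasurableSet (cube n c d ∩ {y | m ≤ b y}) volume :=
      hQ.nullMeasurableSet.inter (nullMeasurableSet_le aemeasurable_const hbm)
    refine ⟨_, {x | b x ≤ m} ∩ cube n (c+v) d, inter_subset_left, hS, inter_subset_right,
      (nullMeasurableSet_le hbm aemeasurable_const).inter hA.nullMeasurableSet, hm1,
      fin _ _ 1 (by simp) inter_subset_left hS inter_subset_right hcase ?_⟩
    rintro x ⟨hx, -⟩ y ⟨-, hy⟩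
    have hx' : b x ≤ m := hx
    have hy' : m ≤ b y := hy
    rw [abs_of_nonneg (by linarith)]
    linarith
  · have hS : NullMeasurableSet (cube n c d \ {y | m ≤ b y}) volume :=
      hQ.nullMeasurableSet.diff (nullMeasurableSet_le aemeasurable_const hbm)
    refine ⟨_, {x | m ≤ b x} ∩ cube n (c+v) d, sdiff_subset, hS, inter_subset_right,
      (nullMeasurableSet_le aemeasurable_const hbm).inter hA.nullMeasurableSet, hm2,
      fin _ _ (-1) (by simp) sdiff_subset hS inter_subset_right (by linarith) ?_⟩
    rintro x ⟨hx, -⟩ y ⟨-, hy⟩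
    have hx' : m ≤ b x := hx
    have hy' : b y < m := not_le.1 hy
    rw [abs_of_nonpos (by linarith)]
    linarith

lemma aux_decay (n : ℕ) (α : ℝ) (hα : α < 2 * n) (d : ℝ) (hd : 0 < d) (δ : ℝ) (hδ : 0 < δ) (B : ℝ) :
    ∃ N : ℕ, ∀ m ≥ N, B ≤ 2^m * d ∧ (2 * (2^m * d / 2)^2) ^ (-((n:ℝ) - α/2)) * d^n *
      (d^n * (2^n * (2*m+6) + 5)) ≤ δ := by
  set β := (n:ℝ) - α/2 with hβ
  have hβ0 : 0 < β := by rw [hβ]; linarith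
  have h1 : Tendsto (fun m : ℕ => (2:ℝ)^m * d) atTop atTop :=
    (tendsto_pow_atTop_atTop_of_one_lt (by norm_num)).atTop_mul_const hd
  set ρ : ℝ := (4:ℝ) ^ (-β) with hρ
  have hρ0 : 0 < ρ := by positivity
  have hρ1 : ρ < 1 := Real.rpow_lt_one_of_one_lt_of_neg (by norm_num) (by linarith)
  have habs : |ρ| < 1 := by rwa [abs_of_pos hρ0]
  have t1 := tendsto_pow_const_mul_const_pow_of_abs_lt_one 1 habs
  have t0 := tendsto_pow_const_mul_const_pow_of_abs_lt_one 0 habs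
  have e : ∀ m : ℕ, (2 * ((2:ℝ)^m * d / 2)^2) ^ (-β) * d^n * (d^n * (2^n * (2*m+6) + 5)) =
      ((d^2/2)^(-β) * d^n * d^n * 2^n * 2) * ((m:ℝ)^1 * ρ^m) +
      ((d^2/2)^(-β) * d^n * d^n * (2^n*6+5)) * ((m:ℝ)^0 * ρ^m) := by
    intro m
    have : (2 * ((2:ℝ)^m * d / 2)^2) ^ (-β) = (d^2/2)^(-β) * ρ^m := by
      have h2 : 2 * ((2:ℝ)^m * d / 2)^2 = (d^2/2) * 4^m := by
        rw [show (4:ℝ) = 2^2 by norm_num, ← pow_mul, mul_comm 2 m, pow_mul]; ring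
      rw [h2, Real.mul_rpow (by positivity) (by positivity), hρ,
        ← Real.rpow_natCast 4 m, ← Real.rpow_natCast _ m, ← Real.rpow_mul (by norm_num),
        ← Real.rpow_mul (by norm_num), mul_comm (m:ℝ)]
    rw [this]; ring
  have t2 : Tendsto (fun m : ℕ => (2 * ((2:ℝ)^m * d / 2)^2) ^ (-β) * d^n *
      (d^n * (2^n * (2*m+6) + 5))) atTop (𝓝 0) := by
    simp_rw [e]
    simpa using (t1.const_mul ((d^2/2)^(-β) * d^n * d^n * 2^n * 2)).add
      (t0.const_mul ((d^2/2)^(-β) * d^n * d^n * (2^n*6+5)))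
  have := (h1.eventually_ge_atTop B).and (t2.eventually (ge_mem_nhds hδ))
  exact eventually_atTop.1 this

lemma aux_offdiag (n : ℕ) (α : ℝ) (hα : α < 2 * n) (b : Rn n → ℝ)
    (hb : LocallyIntegrable b volume) (hbmo : bmoNorm n b = 1) (d : ℝ) (hd : 0 < d)
    (δ : ℝ) (hδ : 0 < δ) :
    ∃ R : ℝ, ∀ a c : Rn n, R ≤ ‖a - c‖ → ∀ S ⊆ cube n c d, NullMeasurableSet S volume →
      ∀ x ∈ cube n a d, |b x - cubeAvg n b a d| ≤ 4 →
      |commI n α b (S.indicator fun _ => 1) ((cube n c d).indicator fun _ => 1) x| ≤ δ := by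
  set D := √(n * (d/2)^2) with hD
  obtain ⟨N, hN⟩ := aux_decay n α hα d hd δ hδ (4 * D)
  refine ⟨2^(N+1)*d, fun a c hac S hSQ hS x hx hbx => ?_⟩
  have h1 : 1 ≤ ‖a - c‖ / d := by
    rw [le_div_iff₀ hd]
    refine le_trans ?_ hac
    gcongr
    exact one_le_pow₀ (by norm_num)
  obtain ⟨m, hm1, hm2⟩ := exists_nat_pow_near h1 (show (1:ℝ) < 2 by norm_num)
  rw [le_div_iff₀ hd] at hm1
  rw [div_lt_iff₀ hd] at hm2
  have hmN : N ≤ m := by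
    have h2 : (2:ℝ)^(N+1) < 2^(m+1) := by
      have := hac.trans_lt hm2
      exact lt_of_mul_lt_mul_right this hd.le
    have := (pow_lt_pow_iff_right₀ (show (1:ℝ) < 2 by norm_num)).1 h2
    omega
  obtain ⟨hm3, hm4⟩ := hN m hmN
  have hQ := aux_cube_meas n c d
  have hQf := aux_cube_ne_top n c d
  have lo : ∀ y ∈ cube n c d, 2^m*d/2 ≤ ‖x - y‖ := by
    intro y hy
    have h2 := aux_cube_norm n _ x d hx
    have h3 := aux_cube_norm n _ y d hy
    have h4 : a - c = (x - y) - (x - a) + (y - c) := by abel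
    have h5 := norm_add_le ((x - y) - (x - a)) (y - c)
    have h6 := norm_sub_le (x - y) (x - a)
    rw [← h4] at h5
    linarith
  have hup := aux_upper n α b (cube n c d) S hQ hQf hS hSQ (aux_int n b hb c d) x _
    fun y hy z hz => aux_frac_upper n α (2^m*d/2) hα (by positivity) x y z (lo y hy) (lo z hz)
  refine hup.trans (le_trans ?_ hm4)
  rw [aux_cube_real n c d hd]
  have hfar := aux_far n b hb hbmo a c d hd m hm2.le
  have hI : ∫ y in cube n c d, |b y - b x| ≤ d^n * (2^n * (2*m+6) + 5) := by
    have h3 : ∫ y in cube n c d, |b y - b x| ≤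
        ∫ y in cube n c d, (|b y - cubeAvg n b c d| + (2^n * (2*m+6) + 4)) := by
      refine integral_mono (aux_int_sub n b hb _ _ _)
        ((aux_int_sub n b hb _ _ _).add (integrableOn_const hQf)) fun y => ?_
      have e1 := abs_sub_le (b y) (cubeAvg n b c d) (b x)
      have e2 := abs_sub_le (cubeAvg n b c d) (cubeAvg n b a d) (b x)
      rw [abs_sub_comm (cubeAvg n b c d) (cubeAvg n b a d), abs_sub_comm _ (b x),
        abs_sub_comm _ (b x)] at e2
      rw [abs_sub_comm (cubeAvg n b c d) (b x)] at e1
      simp only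
      linarith
    rw [integral_add (aux_int_sub n b hb _ _ _) (integrableOn_const hQf),
      aux_osc_eq n b c d hd] at h3
    simp only [integral_const, measureReal_restrict_apply_univ, aux_cube_real n c d hd,
      smul_eq_mul] at h3
    have h4 : d^n * osc n b c d ≤ d^n * 1 := by
      gcongr
      exact aux_osc_le n b hbmo c d hd
    linarith
  gcongr

lemma aux_bad (n : ℕ) (b : Rn n → ℝ)
    (hb : LocallyIntegrable b volume) (hbmo : bmoNorm n b = 1) (d : ℝ) (hd : 0 < d) (a : Rn n)
    (E : Set (Rn n)) (hE : NullMeasurableSet E volume) (hEA : E ⊆ cube n a d)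
    (hEv : d^n/2 ≤ volume.real E) :
    ∃ E' ⊆ E, NullMeasurableSet E' volume ∧ d^n/4 ≤ volume.real E' ∧
      ∀ x ∈ E', |b x - cubeAvg n b a d| ≤ 4 := by
  have hbm : AEMeasurable b volume := hb.aestronglyMeasurable.aemeasurable
  have hA := aux_cube_meas n a d
  have h1 := mul_meas_ge_le_integral_of_nonneg (μ := volume.restrict (cube n a d))
    (f := fun x => |b x - cubeAvg n b a d|) (ae_of_all _ fun x => abs_nonneg _)
    (aux_int_sub n b hb _ _ _) 4
  rw [aux_osc_eq n b a d hd, measureReal_restrict_apply' hA] at h1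
  have h4 : d^n * osc n b a d ≤ d^n * 1 := by
    gcongr
    exact aux_osc_le n b hbmo a d hd
  set B := {x | 4 ≤ |b x - cubeAvg n b a d|} ∩ cube n a d with hB
  have hBm : NullMeasurableSet B volume :=
    (nullMeasurableSet_le aemeasurable_const (hbm.sub_const _).abs).inter hA.nullMeasurableSet
  refine ⟨E \ B, sdiff_subset, hE.diff hBm, ?_, ?_⟩
  · have := le_measureReal_sdiff (μ := volume) (s₁ := E) (s₂ := B)
      (measure_ne_top_of_subset inter_subset_right (aux_cube_ne_top n a d))
    linarith
  · rintro x ⟨hx, hxB⟩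
    by_contra hc
    exact hxB ⟨(not_le.1 hc).le, hEA hx⟩

lemma aux_wnorm_le (n : ℕ) (p s V : ℝ) (hp : 1 < p) (hV : 0 ≤ V) (S : Set (Rn n))
    (hS : volume S ≤ ENNReal.ofReal V) (hs : s = 1 / (1 + V)) :
    wNorm n p (fun _ => 1) (fun x => s * S.indicator (fun _ => 1) x) ≤ ENNReal.ofReal 1 := by
  have hs0 : 0 < s := by rw [hs]; positivity
  have hs1 : s ≤ 1 := by rw [hs, div_le_one (by positivity)]; linarith
  unfold wNorm
  rw [ENNReal.ofReal_one]
  apply ENNReal.rpow_le_one _ (by positivity)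
  calc _ ≤ ∫⁻ x, S.indicator (fun _ => ENNReal.ofReal s) x := by
        refine lintegral_mono fun x => ?_
        by_cases hx : x ∈ S
        · simp only [hx, indicator_of_mem, mul_one]
          apply ENNReal.ofReal_le_ofReal
          rw [abs_of_pos hs0]
          calc s ^ p ≤ s ^ (1:ℝ) := Real.rpow_le_rpow_of_exponent_ge hs0 hs1 hp.le
            _ = s := Real.rpow_one s
        · simp [hx, Real.zero_rpow (by linarith : p ≠ 0)]
    _ ≤ ENNReal.ofReal s * volume S := lintegral_indicator_const_le _ _
    _ ≤ ENNReal.ofReal s * ENNReal.ofReal V := by gcongr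
    _ = ENNReal.ofReal (s * V) := (ENNReal.ofReal_mul hs0.le).symm
    _ ≤ 1 := by
        rw [← ENNReal.ofReal_one]
        apply ENNReal.ofReal_le_ofReal
        rw [hs, one_div, inv_mul_le_one₀ (by positivity)]
        linarith

lemma aux_wnorm_ge (n : ℕ) (q t V : ℝ) (hq : 1 < q) (ht : 0 < t) (hV : 0 < V) (E : Set (Rn n))
    (hE : NullMeasurableSet E volume) (hEV : V ≤ volume.real E)
    (h : Rn n → ℝ) (hh : ∀ x ∈ E, t ≤ |h x|) :
    ENNReal.ofReal (t * V ^ (1/q)) ≤ wNorm n q (fun _ => 1) h := by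
  unfold wNorm
  have hV' : ENNReal.ofReal V ≤ volume E := ENNReal.ofReal_le_of_le_toReal hEV
  have h1 : ENNReal.ofReal (t^q * V) ≤ ∫⁻ x, ENNReal.ofReal (|h x| ^ q * 1) := by
    calc _ = ENNReal.ofReal (t^q) * ENNReal.ofReal V := ENNReal.ofReal_mul (by positivity)
      _ ≤ ENNReal.ofReal (t^q) * volume E := by gcongr
      _ = ∫⁻ x in E, ENNReal.ofReal (t^q) := by rw [setLIntegral_const]
      _ ≤ ∫⁻ x in E, ENNReal.ofReal (|h x| ^ q * 1) := by
          apply lintegral_mono_ae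
          rw [ae_restrict_iff'₀ hE]
          refine ae_of_all _ fun x hx => ?_
          apply ENNReal.ofReal_le_ofReal
          rw [mul_one]
          exact Real.rpow_le_rpow ht.le (hh x hx) (by linarith)
      _ ≤ _ := setLIntegral_le_lintegral _ _
  calc ENNReal.ofReal (t * V ^ (1/q)) = (ENNReal.ofReal (t^q * V)) ^ (1/q) := by
        rw [ENNReal.ofReal_rpow_of_nonneg (by positivity) (by positivity),
          Real.mul_rpow (by positivity) hV.le, ← Real.rpow_mul ht.le,
          mul_one_div_cancel (by linarith), Real.rpow_one]
    _ ≤ _ := ENNReal.rpow_le_rpow h1 (by positivity)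

/-- If `b` is a real-valued BMO function with `‖b‖_{BMO} = 1` whose mean
oscillations stay above `ε` on the translates `Q_j = Q + y_j` of a fixed cube `Q` with
`|y_j| → ∞`, then there are bounded sequences in `L^{p₁}` and `L^{p₂}` whose images under
`[b,I_α]₁` are uniformly separated in `L^q`; in particular `[b,I_α]₁` is not compact from
`L^{p₁} × L^{p₂}` to `L^q`. -/
theorem statement19 (n : ℕ) (hn : 0 < n) (p₁ p₂ q α : ℝ)
    (hp₁ : 1 < p₁) (hp₂ : 1 < p₂)
    (hα₀ : 0 < α) (hα₂ : α < 2 * n)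
    (hαp : α / n < 1 / p₁ + 1 / p₂) (hsum : 1 / p₁ + 1 / p₂ < 2)
    (hq : 1 / q = 1 / p₁ + 1 / p₂ - α / n) (hq' : 1 < q)
    (b : Rn n → ℝ) (hb : LocallyIntegrable b volume) (hbmo : bmoNorm n b = 1)
    (ε : ℝ) (hε : 0 < ε)
    (c₀ : Rn n) (d : ℝ) (hd : 0 < d)
    (y : ℕ → Rn n) (hy : Tendsto (fun j => ‖y j‖) atTop atTop)
    (hosc : ∀ j, ε ≤ osc n b (c₀ + y j) d) :
    ∃ (F G : ℕ → Rn n → ℝ) (c : ℝ), 0 < c ∧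
      (∃ M : ℝ, ∀ j, wNorm n p₁ (fun _ => 1) (F j) ≤ ENNReal.ofReal M) ∧
      (∃ M : ℝ, ∀ j, wNorm n p₂ (fun _ => 1) (G j) ≤ ENNReal.ofReal M) ∧
      (∀ j k : ℕ, j ≠ k →
        ENNReal.ofReal c ≤
          wNorm n q (fun _ => 1)
            (fun x => commI n α b (F j) (G j) x - commI n α b (F k) (G k) x)) ∧
      ¬ BilinCompact n p₁ p₂ q (fun _ => 1) (fun _ => 1) (fun _ => 1) (commI n α b) := by
  obtain ⟨v, c1, hc1, hloc⟩ := aux_local n hn α hα₂ b hb ε hε d hd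
  obtain ⟨R, hR⟩ := aux_offdiag n α hα₂ b hb hbmo d hd (c1/2) (by positivity)
  obtain ⟨φ, -, hφ⟩ := exists_seq_of_forall_finset_exists (fun _ : ℕ => True)
    (fun i j => R + ‖v‖ ≤ ‖y j - y i‖) (by
      intro s _
      have : ∀ᶠ j in atTop, ∀ i ∈ s, R + ‖v‖ ≤ ‖y j - y i‖ := by
        rw [Filter.eventually_all_finset]
        intro i _
        filter_upwards [hy.eventually_ge_atTop (R + ‖v‖ + ‖y i‖)] with j hj
        have := norm_sub_norm_le (y j) (y i)
        linarith
      obtain ⟨j, hj⟩ := this.exists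
      exact ⟨j, trivial, hj⟩)
  have hsep : ∀ j k, j ≠ k → R ≤ ‖(c₀ + y (φ j) + v) - (c₀ + y (φ k))‖ := by
    intro j k hjk
    have h1 : R + ‖v‖ ≤ ‖y (φ j) - y (φ k)‖ := by
      rcases lt_or_gt_of_ne hjk with h | h
      · rw [norm_sub_rev]; exact hφ j k h
      · exact hφ k j h
    have h2 : y (φ j) - y (φ k) = ((c₀ + y (φ j) + v) - (c₀ + y (φ k))) - v := by abel
    have h3 := norm_sub_le ((c₀ + y (φ j) + v) - (c₀ + y (φ k))) v
    rw [← h2] at h3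
    linarith
  choose S E hSQ hS hEA hE hEv hlow using fun j => hloc (c₀ + y (φ j)) (hosc (φ j))
  choose E' hE'E hE' hE'v hE'b using fun j =>
    aux_bad n b hb hbmo d hd (c₀ + y (φ j) + v) (E j) (hE j) (hEA j) (hEv j)
  set s : ℝ := 1 / (1 + d^n) with hs
  have hs0 : 0 < s := by positivity
  set F : ℕ → Rn n → ℝ := fun j x => s * (S j).indicator (fun _ => 1) x with hF
  set G : ℕ → Rn n → ℝ := fun j x => s * (cube n (c₀ + y (φ j)) d).indicator (fun _ => 1) x with hG
  have hvol : ∀ c, volume (cube n c d) ≤ ENNReal.ofReal (d^n) := by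
    intro c
    rw [aux_cube_vol, ENNReal.ofReal_pow hd.le]
  have hFn : ∀ j, wNorm n p₁ (fun _ => 1) (F j) ≤ ENNReal.ofReal 1 := fun j =>
    aux_wnorm_le n p₁ s (d^n) hp₁ (by positivity) (S j)
      ((measure_mono (hSQ j)).trans (hvol _)) hs
  have hGn : ∀ j, wNorm n p₂ (fun _ => 1) (G j) ≤ ENNReal.ofReal 1 := fun j =>
    aux_wnorm_le n p₂ s (d^n) hp₂ (by positivity) _ (hvol _) hs
  set cc : ℝ := (s * s * (c1/2)) * (d^n/4) ^ (1/q) with hcc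
  have hccpos : 0 < cc := by positivity
  have hsepq : ∀ j k : ℕ, j ≠ k →
        ENNReal.ofReal cc ≤
          wNorm n q (fun _ => 1)
            (fun x => commI n α b (F j) (G j) x - commI n α b (F k) (G k) x) := by
    intro j k hjk
    refine aux_wnorm_ge n q _ (d^n/4) hq' (by positivity) (by positivity) (E' j) (hE' j) (hE'v j) _ ?_
    intro x hx
    simp only [hF, hG]
    rw [aux_commI_scale, aux_commI_scale, ← mul_sub, abs_mul, abs_of_pos (by positivity : 0 < s*s)]
    have h1 := hlow j x (hE'E j hx)
    have h2 := hR _ _ (hsep j k hjk) (S k) (hSQ k) (hS k) x (hEA j (hE'E j hx)) (hE'b j x hx)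
    refine mul_le_mul_of_nonneg_left ?_ (by positivity)
    refine le_trans ?_ (abs_sub_abs_le_abs_sub _ _)
    linarith
  refine ⟨F, G, cc, hccpos, ⟨1, hFn⟩, ⟨1, hGn⟩, hsepq, ?_⟩
  intro hcomp
  obtain ⟨ψ, hψ, hψ2⟩ := hcomp F G (by simpa using hFn) (by simpa using hGn)
  obtain ⟨N, hN⟩ := hψ2 cc hccpos
  have h1 := hN N le_rfl (N+1) (Nat.le_succ N)
  have h2 := hsepq (ψ N) (ψ (N+1)) (hψ (Nat.lt_succ_self N)).ne
  exact absurd h1 (not_lt.2 h2)
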